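/- Let d ≥ 1, let V : ℝ^d → ℝ be continuous with Z_V := ∫ e^{−V} < ∞ and Z_{2V} := ∫ e^{−2V} < ∞, let t > 0, n ≥ 1, z ∈ ℝ^d, and let y_1, …, y_n be i.i.d. samples from N(0, (1−e^{−2t}) I_d). Define the self-normalized score estimator ŝ_{t,n}(z) := −(1/(1−e^{−2t})) · (Σ_{i=1}^n y_i e^{−V(e^t(z−y_i))}) / (Σ_{i=1}^n e^{−V(e^t(z−y_i))}). Then E[‖ŝ_{t,n}(z) − ∇ log p_t^V(z)‖²] ≤ (32 e² (d + log n)/(n(1−e^{−2t}))) · (1 + θ_t(z) · p_t^{2V}(z) Z_{2V} e^{td} / (p_t^V(z) Z_V)²), where θ_t(z) = Δ log p_t^{2V}(z) + d/(1−e^{−2t}) + ‖∇ log p_t^V(z)‖² + ‖∇ log p_t^{2V}(z)‖² + 1. -/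

import Mathlib

open Real MeasureTheory
open scoped RealInnerProductSpace

/-- The forward Ornstein–Uhlenbeck density at time `t`, started at `μ = e^{-W}/∫ e^{-W}`. -/
noncomputable def ouDensity (d : ℕ) (W : EuclideanSpace ℝ (Fin d) → ℝ) (t : ℝ)
    (z : EuclideanSpace ℝ (Fin d)) : ℝ :=
  (2 * π * (1 - exp (-2 * t))) ^ (-(d : ℝ) / 2) *
    ∫ x : EuclideanSpace ℝ (Fin d),
      exp (-‖z - exp (-t) • x‖ ^ 2 / (2 * (1 - exp (-2 * t)))) *
        (exp (-W x) / ∫ y : EuclideanSpace ℝ (Fin d), exp (-W y))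

/-- The density of the centered Gaussian `N(0, s I_d)` on `ℝ^d`. -/
noncomputable def gaussDens (d : ℕ) (s : ℝ) (y : EuclideanSpace ℝ (Fin d)) : ℝ :=
  (2 * π * s) ^ (-(d : ℝ) / 2) * exp (-‖y‖ ^ 2 / (2 * s))

/-- The self-normalized score estimator
`ŝ_{t,n}(z) = -(1/(1-e^{-2t})) (∑ᵢ yᵢ e^{-V(e^t(z-yᵢ))}) / (∑ᵢ e^{-V(e^t(z-yᵢ))})`. -/
noncomputable def selfNormEst (d n : ℕ) (V : EuclideanSpace ℝ (Fin d) → ℝ) (t : ℝ)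
    (z : EuclideanSpace ℝ (Fin d)) (y : Fin n → EuclideanSpace ℝ (Fin d)) :
    EuclideanSpace ℝ (Fin d) :=
  (-(1 / (1 - exp (-2 * t)))) •
    (∑ i, exp (-V (exp t • (z - y i))))⁻¹ • ∑ i, exp (-V (exp t • (z - y i))) • y i

open ProbabilityTheory in
/-- The second moment of a sum of i.i.d. centered square-integrable real variables. -/
lemma integral_sq_sum_pi_of_integral_eq_zero {α : Type*} [MeasurableSpace α] (γ : Measure α)
    [IsProbabilityMeasure γ] (n : ℕ) (f : α → ℝ) (hf : MemLp f 2 γ) (h0 : ∫ x, f x ∂γ = 0) :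
    Integrable (fun y : Fin n → α => (∑ i, f (y i)) ^ 2) (Measure.pi fun _ => γ) ∧
      ∫ y : Fin n → α, (∑ i, f (y i)) ^ 2 ∂(Measure.pi fun _ => γ) = n * ∫ x, f x ^ 2 ∂γ := by
  have hcomp : ∀ i : Fin n, MemLp (fun y : Fin n → α => f (y i)) 2 (Measure.pi fun _ => γ) :=
    fun i => hf.comp_measurePreserving (measurePreserving_eval (fun _ : Fin n => γ) i)
  have hsum : MemLp (fun y : Fin n → α => ∑ i, f (y i)) 2 (Measure.pi fun _ => γ) :=
    memLp_finsetSum _ fun i _ => hcomp i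
  refine ⟨hsum.integrable_sq, ?_⟩
  have hv := variance_sum_pi (μ := fun _ : Fin n => γ) (X := fun _ => f) fun _ => hf
  have hfun : (∑ i : Fin n, fun ω : Fin n → α => f (ω i)) = fun ω => ∑ i, f (ω i) := by
    ext ω
    simp
  have hmean : ∫ y : Fin n → α, ∑ i, f (y i) ∂(Measure.pi fun _ => γ) = 0 := by
    rw [integral_finsetSum _ fun i _ => (hcomp i).integrable (by norm_num)]
    refine Finset.sum_eq_zero fun i _ => ?_
    rw [integral_comp_eval (μ := fun _ : Fin n => γ) (i := i) hf.1, h0]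
  rw [hfun, variance_of_integral_eq_zero hsum.1.aemeasurable hmean,
    variance_of_integral_eq_zero hf.1.aemeasurable h0] at hv
  simpa using hv

/-- The second moment of a sum of i.i.d. centered square-integrable random vectors. -/
lemma integral_norm_sq_sum_pi_of_integral_eq_zero {α : Type*} [MeasurableSpace α] (γ : Measure α)
    [IsProbabilityMeasure γ] (d n : ℕ) (f : α → EuclideanSpace ℝ (Fin d)) (hf : MemLp f 2 γ)
    (h0 : ∫ x, f x ∂γ = 0) :
    Integrable (fun y : Fin n → α => ‖∑ i, f (y i)‖ ^ 2) (Measure.pi fun _ => γ) ∧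
      ∫ y : Fin n → α, ‖∑ i, f (y i)‖ ^ 2 ∂(Measure.pi fun _ => γ) = n * ∫ x, ‖f x‖ ^ 2 ∂γ := by
  have hk : ∀ k, MemLp (fun x => f x k) 2 γ := fun k =>
    hf.continuousLinearMap_comp (EuclideanSpace.proj k : EuclideanSpace ℝ (Fin d) →L[ℝ] ℝ)
  have hk0 : ∀ k, ∫ x, f x k ∂γ = 0 := fun k => by
    have h := (EuclideanSpace.proj k : EuclideanSpace ℝ (Fin d) →L[ℝ] ℝ).integral_comp_comm
      (hf.integrable (by norm_num))
    simpa [h0] using h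
  have hs := fun k => integral_sq_sum_pi_of_integral_eq_zero γ n (fun x => f x k) (hk k) (hk0 k)
  have e1 : ∀ y : Fin n → α, ‖∑ i, f (y i)‖ ^ 2 = ∑ k, (∑ i, f (y i) k) ^ 2 := fun y => by
    simp [EuclideanSpace.norm_sq_eq]
  have e2 : ∀ x, ‖f x‖ ^ 2 = ∑ k, (f x k) ^ 2 := fun x => by
    simp [EuclideanSpace.norm_sq_eq]
  simp only [e1, e2]
  refine ⟨integrable_finsetSum _ fun k _ => (hs k).1, ?_⟩
  rw [integral_finsetSum _ fun k _ => (hs k).1,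
    integral_finsetSum _ fun k _ => (hk k).integrable_sq, Finset.mul_sum]
  exact Finset.sum_congr rfl fun k _ => (hs k).2

/-- A pointwise bound for the error of a weighted average, which does not see whether the total
weight is close to its expectation. -/
lemma norm_weighted_average_sub_sq_le {E : Type*} [NormedAddCommGroup E] [NormedSpace ℝ E]
    {n : ℕ} (hn : 1 ≤ n) (w : Fin n → ℝ) (hw : ∀ i, 0 < w i) (y : Fin n → E) (m : E)
    {A a s : ℝ} (hA : 0 < A) (ha : 0 ≤ a) (hs : 0 < s) :
    ‖(∑ i, w i)⁻¹ • ∑ i, w i • y i - m‖ ^ 2 ≤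
      4 / (n * A) ^ 2 * ‖∑ i, w i • (y i - m)‖ ^ 2 +
      8 * (‖m‖ ^ 2 + a) / (n * A) ^ 2 * (∑ i, (w i - A)) ^ 2 +
      8 * s * exp (-(a / (4 * s))) * ∑ i, exp (‖y i‖ ^ 2 / (4 * s)) := by
  have hn0 : (0 : ℝ) < n := by exact_mod_cast hn
  have : Nonempty (Fin n) := ⟨⟨0, hn⟩⟩
  set S := ∑ i, w i with hSdef
  have hS : 0 < S := Finset.sum_pos (fun i _ => hw i) Finset.univ_nonempty
  have hrew : S⁻¹ • ∑ i, w i • y i - m = S⁻¹ • ∑ i, w i • (y i - m) := by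
    simp only [smul_sub, Finset.sum_sub_distrib, ← Finset.sum_smul]
    rw [← hSdef, inv_smul_smul₀ hS.ne']
  have hSA : ∑ i, (w i - A) = S - n * A := by
    simp [Finset.sum_sub_distrib, hSdef]
  have hnA : 0 < n * A := by positivity
  have hexp : 0 ≤ ∑ i, exp (‖y i‖ ^ 2 / (4 * s)) := Finset.sum_nonneg fun i _ => (exp_pos _).le
  rw [hSA]
  rcases le_total (n * A) (2 * S) with h | h
  · have h1 : ‖S⁻¹ • ∑ i, w i • y i - m‖ ^ 2 ≤ 4 / (n * A) ^ 2 * ‖∑ i, w i • (y i - m)‖ ^ 2 := by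
      rw [hrew, norm_smul, mul_pow]
      gcongr
      rw [norm_inv, Real.norm_of_nonneg hS.le, inv_pow, inv_eq_one_div, div_le_div_iff₀ (by positivity)
        (by positivity)]
      nlinarith
    have h2 : 0 ≤ 8 * (‖m‖ ^ 2 + a) / (n * A) ^ 2 * (S - n * A) ^ 2 := by positivity
    have h3 : 0 ≤ 8 * s * exp (-(a / (4 * s))) * ∑ i, exp (‖y i‖ ^ 2 / (4 * s)) := by positivity
    linarith
  · have hpt : ∀ i, ‖y i‖ ^ 2 ≤ a +
        4 * s * exp (-(a / (4 * s))) * ∑ j, exp (‖y j‖ ^ 2 / (4 * s)) := fun i => by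
      have hb := add_one_le_exp (‖y i‖ ^ 2 / (4 * s) - a / (4 * s))
      have hle : exp (‖y i‖ ^ 2 / (4 * s)) ≤ ∑ j, exp (‖y j‖ ^ 2 / (4 * s)) :=
        Finset.single_le_sum (f := fun j => exp (‖y j‖ ^ 2 / (4 * s)))
          (fun j _ => (exp_pos _).le) (Finset.mem_univ i)
      rw [sub_eq_add_neg, exp_add] at hb
      have hc : ‖y i‖ ^ 2 - a ≤ 4 * s * (exp (‖y i‖ ^ 2 / (4 * s)) * exp (-(a / (4 * s)))) := by
        have : ‖y i‖ ^ 2 - a = 4 * s * (‖y i‖ ^ 2 / (4 * s) + -(a / (4 * s))) := by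
          field_simp
          ring
        rw [this]
        gcongr
        linarith
      have hd : 4 * s * (exp (‖y i‖ ^ 2 / (4 * s)) * exp (-(a / (4 * s)))) ≤
          4 * s * ((∑ j, exp (‖y j‖ ^ 2 / (4 * s))) * exp (-(a / (4 * s)))) := by
        gcongr
      linarith
    set T := 4 * s * exp (-(a / (4 * s))) * ∑ j, exp (‖y j‖ ^ 2 / (4 * s)) with hT
    have hT0 : 0 ≤ T := by positivity
    have hmain : ‖S⁻¹ • ∑ i, w i • y i - m‖ ≤ √(a + T) + ‖m‖ := by
      refine (norm_sub_le _ _).trans ?_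
      gcongr
      rw [norm_smul, norm_inv, Real.norm_of_nonneg hS.le, inv_mul_le_iff₀ hS]
      refine (norm_sum_le _ _).trans ?_
      rw [hSdef, Finset.sum_mul]
      gcongr with i
      rw [norm_smul, Real.norm_of_nonneg (hw i).le]
      have := hw i
      gcongr
      exact Real.le_sqrt_of_sq_le (hpt i)
    have hsq := Real.sq_sqrt (show 0 ≤ a + T by positivity)
    have h1 : ‖S⁻¹ • ∑ i, w i • y i - m‖ ^ 2 ≤ 2 * (a + T) + 2 * ‖m‖ ^ 2 := by
      have h3 : ‖S⁻¹ • ∑ i, w i • y i - m‖ ^ 2 ≤ (√(a + T) + ‖m‖) ^ 2 := by gcongr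
      nlinarith [sq_nonneg (√(a + T) - ‖m‖)]
    have h2 : 2 * (‖m‖ ^ 2 + a) ≤ 8 * (‖m‖ ^ 2 + a) / (n * A) ^ 2 * (S - n * A) ^ 2 := by
      rw [div_mul_eq_mul_div, le_div_iff₀ (by positivity)]
      have hq : (n * A) ^ 2 ≤ 4 * (S - n * A) ^ 2 := by nlinarith
      nlinarith [mul_le_mul_of_nonneg_left hq (show 0 ≤ 2 * (‖m‖ ^ 2 + a) by positivity)]
    have h3 : 0 ≤ 4 / (n * A) ^ 2 * ‖∑ i, w i • (y i - m)‖ ^ 2 := by positivity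
    have h4 : 8 * s * exp (-(a / (4 * s))) * ∑ i, exp (‖y i‖ ^ 2 / (4 * s)) = 2 * T := by
      rw [hT]
      ring
    linarith

/-- Quadratic error of a self-normalized importance sampling estimator of the mean of a weighted
probability measure with Gaussian tails. -/
lemma lintegral_norm_weighted_average_sub_sq_le {d n : ℕ} (hn : 1 ≤ n)
    (γ : Measure (EuclideanSpace ℝ (Fin d))) [IsProbabilityMeasure γ]
    (w : EuclideanSpace ℝ (Fin d) → ℝ) (hw : Continuous w) (hpos : ∀ y, 0 < w y)
    (hw2 : Integrable (fun y => w y ^ 2) γ)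
    (hwy2 : Integrable (fun y => w y ^ 2 * ‖y‖ ^ 2) γ)
    {s : ℝ} (hs : 0 < s) (hexp : Integrable (fun y => exp (‖y‖ ^ 2 / (4 * s))) γ)
    (hexp2 : ∫ y, exp (‖y‖ ^ 2 / (4 * s)) ∂γ ≤ exp (d * Real.log 2 / 2))
    {A : ℝ} (hA : ∫ y, w y ∂γ = A) (hApos : 0 < A)
    {m : EuclideanSpace ℝ (Fin d)} (hm : ∫ y, w y • y ∂γ = A • m) :
    ∫⁻ y : Fin n → EuclideanSpace ℝ (Fin d),
        ENNReal.ofReal (‖(∑ i, w (y i))⁻¹ • ∑ i, w (y i) • y i - m‖ ^ 2)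
          ∂(Measure.pi fun _ => γ) ≤
      ENNReal.ofReal (8 / n * ((∫ y, w y ^ 2 * ‖y‖ ^ 2 ∂γ) / A ^ 2 +
        (2 * ‖m‖ ^ 2 + 8 * s * (d + Real.log n)) * ((∫ y, w y ^ 2 ∂γ) / A ^ 2) + s)) := by
  have hn0 : (0 : ℝ) < n := by exact_mod_cast hn
  have hlog : 0 ≤ Real.log n := Real.log_nonneg (by exact_mod_cast hn)
  have hlog2 : 0 ≤ Real.log 2 := Real.log_nonneg (by norm_num)
  set a := 4 * s * (d * Real.log 2 / 2 + 2 * Real.log n) with ha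
  have ha0 : 0 ≤ a := by positivity
  set B := ∫ y, w y ^ 2 ∂γ with hB
  set C := ∫ y, w y ^ 2 * ‖y‖ ^ 2 ∂γ with hC
  have hB0 : 0 ≤ B := integral_nonneg fun y => sq_nonneg _
  have hC0 : 0 ≤ C := integral_nonneg fun y => by positivity
  have hwL : MemLp w 2 γ := (memLp_two_iff_integrable_sq hw.aestronglyMeasurable).2 hw2
  have hwyL : MemLp (fun y => w y • y) 2 γ := by
    refine (memLp_two_iff_integrable_sq_norm (by fun_prop)).2 ?_
    simpa [norm_smul, mul_pow] using hwy2
  have hwyi : Integrable (fun y => w y • y) γ := hwyL.integrable (by norm_num)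
  have hwi : Integrable w γ := hwL.integrable (by norm_num)
  obtain ⟨hN1, hN2⟩ := integral_norm_sq_sum_pi_of_integral_eq_zero γ d n (fun y => w y • (y - m))
    (by
      simp only [smul_sub]
      exact hwyL.sub ((memLp_two_iff_integrable_sq_norm (by fun_prop)).2
        (by simpa [norm_smul, mul_pow] using hw2.mul_const (‖m‖ ^ 2))))
    (by
      simp only [smul_sub]
      rw [integral_sub hwyi (hwi.smul_const m), integral_smul_const, hm, hA, sub_self])
  obtain ⟨hS1, hS2⟩ := integral_sq_sum_pi_of_integral_eq_zero γ n (fun y => w y - A)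
    (hwL.sub (memLp_const A))
    (by rw [integral_sub hwi (integrable_const A), hA]; simp)
  have hE1 : Integrable (fun y : Fin n → EuclideanSpace ℝ (Fin d) =>
      ∑ i, exp (‖y i‖ ^ 2 / (4 * s))) (Measure.pi fun _ => γ) :=
    integrable_finsetSum _ fun i _ => integrable_comp_eval (μ := fun _ : Fin n => γ) (i := i) hexp
  have hE2 : ∫ y : Fin n → EuclideanSpace ℝ (Fin d), ∑ i, exp (‖y i‖ ^ 2 / (4 * s))
      ∂(Measure.pi fun _ => γ) = n * ∫ y, exp (‖y‖ ^ 2 / (4 * s)) ∂γ := by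
    rw [integral_finsetSum _ fun i _ =>
      integrable_comp_eval (μ := fun _ : Fin n => γ) (i := i) hexp]
    have : ∀ i : Fin n, ∫ y : Fin n → EuclideanSpace ℝ (Fin d), exp (‖y i‖ ^ 2 / (4 * s))
        ∂(Measure.pi fun _ => γ) = ∫ y, exp (‖y‖ ^ 2 / (4 * s)) ∂γ := fun i =>
      integral_comp_eval (μ := fun _ : Fin n => γ) (i := i)
        (f := fun y => exp (‖y‖ ^ 2 / (4 * s))) hexp.1
    simp [this]
  have hNle : ∫ y, ‖w y • (y - m)‖ ^ 2 ∂γ ≤ 2 * C + 2 * ‖m‖ ^ 2 * B := by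
    rw [hB, hC, ← integral_const_mul, ← integral_const_mul,
      ← integral_add (hwy2.const_mul _) (hw2.const_mul _)]
    refine integral_mono_of_nonneg (.of_forall fun y => by positivity)
      ((hwy2.const_mul _).add (hw2.const_mul _)) (.of_forall fun y => ?_)
    have h1 : ‖y - m‖ ^ 2 ≤ (‖y‖ + ‖m‖) ^ 2 := by
      gcongr
      exact norm_sub_le _ _
    have h2 : ‖y - m‖ ^ 2 ≤ 2 * ‖y‖ ^ 2 + 2 * ‖m‖ ^ 2 := by nlinarith [sq_nonneg (‖y‖ - ‖m‖)]
    have h3 := mul_le_mul_of_nonneg_left h2 (sq_nonneg (w y))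
    simp only [norm_smul, mul_pow, Real.norm_eq_abs, sq_abs]
    linarith
  have hSle : ∫ y, (w y - A) ^ 2 ∂γ ≤ B := by
    have h : ∫ y, (w y - A) ^ 2 ∂γ = B - A ^ 2 := by
      have : ∀ y, (w y - A) ^ 2 = w y ^ 2 + (A ^ 2 - 2 * A * w y) := fun y => by ring
      have hd : Integrable (fun y => A ^ 2 - 2 * A * w y) γ :=
        (integrable_const _).sub (hwi.const_mul _)
      simp only [this]
      rw [integral_add hw2 hd, integral_sub (integrable_const _) (hwi.const_mul _), integral_const_mul, hA]
      simp
      ring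
    rw [h]
    linarith [sq_nonneg A]
  calc _ ≤ ∫⁻ y : Fin n → EuclideanSpace ℝ (Fin d), ENNReal.ofReal
          (4 / (n * A) ^ 2 * ‖∑ i, w (y i) • (y i - m)‖ ^ 2 +
          8 * (‖m‖ ^ 2 + a) / (n * A) ^ 2 * (∑ i, (w (y i) - A)) ^ 2 +
          8 * s * exp (-(a / (4 * s))) * ∑ i, exp (‖y i‖ ^ 2 / (4 * s)))
          ∂(Measure.pi fun _ => γ) :=
        lintegral_mono fun y => ENNReal.ofReal_le_ofReal
          (norm_weighted_average_sub_sq_le hn _ (fun i => hpos _) y m hApos ha0 hs)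
    _ ≤ _ := by
        have hNS : Integrable (fun y : Fin n → EuclideanSpace ℝ (Fin d) =>
            4 / (n * A) ^ 2 * ‖∑ i, w (y i) • (y i - m)‖ ^ 2 +
            8 * (‖m‖ ^ 2 + a) / (n * A) ^ 2 * (∑ i, (w (y i) - A)) ^ 2)
            (Measure.pi fun _ => γ) := (hN1.const_mul _).add (hS1.const_mul _)
        rw [← ofReal_integral_eq_lintegral_ofReal (hNS.fun_add (hE1.const_mul _))
          (.of_forall fun y => by positivity)]
        refine ENNReal.ofReal_le_ofReal ?_
        rw [integral_add hNS (hE1.const_mul _),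
          integral_add (hN1.const_mul _) (hS1.const_mul _), integral_const_mul,
          integral_const_mul, integral_const_mul, hN2, hS2, hE2]
        have t1 : 4 / (n * A) ^ 2 * (n * ∫ y, ‖w y • (y - m)‖ ^ 2 ∂γ) ≤
            8 / n * (C / A ^ 2 + ‖m‖ ^ 2 * (B / A ^ 2)) := by
          calc _ ≤ 4 / (n * A) ^ 2 * (n * (2 * C + 2 * ‖m‖ ^ 2 * B)) := by gcongr
            _ = _ := by
              field_simp
              ring
        have t2 : 8 * (‖m‖ ^ 2 + a) / (n * A) ^ 2 * (n * ∫ y, (w y - A) ^ 2 ∂γ) ≤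
            8 / n * ((‖m‖ ^ 2 + 8 * s * (d + Real.log n)) * (B / A ^ 2)) := by
          have hale : a ≤ 8 * s * (d + Real.log n) := by
            have : Real.log 2 ≤ 1 := by linarith [Real.log_two_lt_d9]
            have hd0 : (0 : ℝ) ≤ d := by positivity
            have : d * Real.log 2 / 2 + 2 * Real.log n ≤ 2 * (d + Real.log n) := by nlinarith
            rw [ha]
            nlinarith
          calc _ ≤ 8 * (‖m‖ ^ 2 + 8 * s * (d + Real.log n)) / (n * A) ^ 2 * (n * B) := by gcongr
            _ = _ := by field_simp
        have t3 : 8 * s * exp (-(a / (4 * s))) * (n * ∫ y, exp (‖y‖ ^ 2 / (4 * s)) ∂γ) ≤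
            8 / n * s := by
          have hae : exp (-(a / (4 * s))) * exp (d * Real.log 2 / 2) = ((n : ℝ) ^ 2)⁻¹ := by
            have : a / (4 * s) = d * Real.log 2 / 2 + 2 * Real.log n := by
              rw [ha]
              field_simp
            rw [← exp_add, this, ← Real.exp_log (show (0 : ℝ) < ((n : ℝ) ^ 2)⁻¹ by positivity),
              Real.log_inv, Real.log_pow]
            congr 1
            push_cast
            ring
          calc _ ≤ 8 * s * exp (-(a / (4 * s))) * (n * exp (d * Real.log 2 / 2)) := by gcongr
            _ = 8 * s * n * (exp (-(a / (4 * s))) * exp (d * Real.log 2 / 2)) := by ring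
            _ = _ := by
              rw [hae]
              field_simp
        have e : 8 / n * (C / A ^ 2 +
            (2 * ‖m‖ ^ 2 + 8 * s * (d + Real.log n)) * (B / A ^ 2) + s) =
            8 / n * (C / A ^ 2 + ‖m‖ ^ 2 * (B / A ^ 2)) +
            8 / n * ((‖m‖ ^ 2 + 8 * s * (d + Real.log n)) * (B / A ^ 2)) + 8 / n * s := by ring
        rw [e]
        exact add_le_add (add_le_add t1 t2) t3

/-- The product of measures with densities has the product density. -/
lemma pi_withDensity_ofReal {α : Type*} [MeasurableSpace α] (μ : Measure α) [SigmaFinite μ]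
    (n : ℕ) (g : α → ℝ) (hg : ∀ x, 0 ≤ g x) (hgi : Integrable g μ) :
    Measure.pi (fun _ : Fin n => μ.withDensity fun x => ENNReal.ofReal (g x)) =
      (Measure.pi fun _ : Fin n => μ).withDensity fun y => ENNReal.ofReal (∏ i, g (y i)) := by
  have := isFiniteMeasure_withDensity_ofReal hgi.2
  refine Measure.pi_eq fun S hS => ?_
  have hint : Integrable (fun y : Fin n → α => ∏ i, g (y i))
      (Measure.pi fun i : Fin n => μ.restrict (S i)) :=
    Integrable.fintype_prod fun i => hgi.restrict
  rw [withDensity_apply _ (MeasurableSet.univ_pi hS), Measure.restrict_pi_pi,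
    ← ofReal_integral_eq_lintegral_ofReal hint
      (.of_forall fun y => Finset.prod_nonneg fun i _ => hg _),
    integral_fintype_prod_eq_prod (fun _ => g),
    ENNReal.ofReal_prod_of_nonneg fun i _ => integral_nonneg hg]
  refine Finset.prod_congr rfl fun i _ => ?_
  rw [withDensity_apply _ (hS i), ← ofReal_integral_eq_lintegral_ofReal hgi.restrict
    (.of_forall hg)]

lemma integral_withDensity_ofReal {α F : Type*} [MeasurableSpace α] [NormedAddCommGroup F]
    [NormedSpace ℝ F] (μ : Measure α) (g : α → ℝ) (hg : ∀ x, 0 ≤ g x) (hgm : Measurable g)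
    (h : α → F) :
    ∫ x, h x ∂(μ.withDensity fun x => ENNReal.ofReal (g x)) = ∫ x, g x • h x ∂μ := by
  rw [integral_withDensity_eq_integral_toReal_smul (by fun_prop) (by simp)]
  simp [ENNReal.toReal_ofReal (hg _)]

lemma integrable_withDensity_ofReal {α F : Type*} [MeasurableSpace α] [NormedAddCommGroup F]
    [NormedSpace ℝ F] (μ : Measure α) (g : α → ℝ) (hg : ∀ x, 0 ≤ g x) (hgm : Measurable g)
    (h : α → F) :
    Integrable h (μ.withDensity fun x => ENNReal.ofReal (g x)) ↔
      Integrable (fun x => g x • h x) μ := by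
  rw [integrable_withDensity_iff_integrable_smul' (by fun_prop) (by simp)]
  simp [ENNReal.toReal_ofReal (hg _)]

lemma gaussDens_pos (d : ℕ) {s : ℝ} (hs : 0 < s) (y : EuclideanSpace ℝ (Fin d)) :
    0 < gaussDens d s y := by
  unfold gaussDens
  positivity

lemma continuous_gaussDens (d : ℕ) (s : ℝ) : Continuous (gaussDens d s) := by
  unfold gaussDens
  fun_prop

/-- The Gaussian measure `N(0, s I_d)`. -/
noncomputable def gaussMeas (d : ℕ) (s : ℝ) : Measure (EuclideanSpace ℝ (Fin d)) :=
  volume.withDensity fun y => ENNReal.ofReal (gaussDens d s y)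

lemma integrable_exp_neg_mul_norm_sq (d : ℕ) {b : ℝ} (hb : 0 < b) :
    Integrable fun y : EuclideanSpace ℝ (Fin d) => exp (-b * ‖y‖ ^ 2) := by
  by_contra h
  have h1 := GaussianFourier.integral_rexp_neg_mul_sq_norm (V := EuclideanSpace ℝ (Fin d)) hb
  rw [integral_undef h] at h1
  have : 0 < (π / b) ^ ((Module.finrank ℝ (EuclideanSpace ℝ (Fin d)) : ℝ) / 2) := by positivity
  linarith

lemma gaussDens_eq (d : ℕ) {s : ℝ} (y : EuclideanSpace ℝ (Fin d)) :
    gaussDens d s y = (2 * π * s) ^ (-(d : ℝ) / 2) * exp (-(1 / (2 * s)) * ‖y‖ ^ 2) := by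
  unfold gaussDens
  congr 2
  ring

lemma integrable_gaussDens (d : ℕ) {s : ℝ} (hs : 0 < s) : Integrable (gaussDens d s) := by
  have h : gaussDens d s = fun y => (2 * π * s) ^ (-(d : ℝ) / 2) *
      exp (-(1 / (2 * s)) * ‖y‖ ^ 2) := funext fun y => gaussDens_eq d y
  rw [h]
  exact (integrable_exp_neg_mul_norm_sq d (by positivity)).const_mul _

lemma integral_gaussDens (d : ℕ) {s : ℝ} (hs : 0 < s) : ∫ y, gaussDens d s y = 1 := by
  simp only [gaussDens_eq]
  rw [integral_const_mul, GaussianFourier.integral_rexp_neg_mul_sq_norm (by positivity)]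
  have h : π / (1 / (2 * s)) = 2 * π * s := by
    field_simp
  rw [h, finrank_euclideanSpace_fin, ← Real.rpow_add (by positivity)]
  simp [neg_div]

lemma gaussDens_smul_exp (d : ℕ) {s : ℝ} (hs : 0 < s) (y : EuclideanSpace ℝ (Fin d)) :
    gaussDens d s y • exp (‖y‖ ^ 2 / (4 * s)) =
      (2 * π * s) ^ (-(d : ℝ) / 2) * exp (-(1 / (4 * s)) * ‖y‖ ^ 2) := by
  rw [gaussDens_eq, smul_eq_mul, mul_assoc, ← exp_add]
  congr 2
  field_simp
  ring

lemma isProbabilityMeasure_gaussMeas (d : ℕ) {s : ℝ} (hs : 0 < s) :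
    IsProbabilityMeasure (gaussMeas d s) := by
  refine ⟨?_⟩
  rw [gaussMeas, withDensity_apply _ MeasurableSet.univ, Measure.restrict_univ,
    ← ofReal_integral_eq_lintegral_ofReal (integrable_gaussDens d hs)
      (.of_forall fun y => (gaussDens_pos d hs y).le), integral_gaussDens d hs, ENNReal.ofReal_one]

lemma integrable_exp_norm_sq_gaussMeas (d : ℕ) {s : ℝ} (hs : 0 < s) :
    Integrable (fun y => exp (‖y‖ ^ 2 / (4 * s))) (gaussMeas d s) := by
  rw [gaussMeas, integrable_withDensity_ofReal _ _ (fun y => (gaussDens_pos d hs y).le)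
    (continuous_gaussDens d s).measurable]
  simp only [gaussDens_smul_exp d hs]
  exact (integrable_exp_neg_mul_norm_sq d (by positivity)).const_mul _

lemma integral_exp_norm_sq_gaussMeas (d : ℕ) {s : ℝ} (hs : 0 < s) :
    ∫ y, exp (‖y‖ ^ 2 / (4 * s)) ∂(gaussMeas d s) = exp (d * Real.log 2 / 2) := by
  rw [gaussMeas, integral_withDensity_ofReal _ _ (fun y => (gaussDens_pos d hs y).le)
    (continuous_gaussDens d s).measurable]
  simp only [gaussDens_smul_exp d hs]
  rw [integral_const_mul, GaussianFourier.integral_rexp_neg_mul_sq_norm (by positivity)]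
  have h : π / (1 / (4 * s)) = 2 * (2 * π * s) := by
    field_simp
    ring
  rw [h, finrank_euclideanSpace_fin, Real.mul_rpow (x := 2) (y := 2 * π * s) (by norm_num) (by positivity), mul_left_comm,
    ← Real.rpow_add (by positivity), Real.rpow_def_of_pos (by norm_num : (0 : ℝ) < 2)]
  simp only [neg_div, neg_add_cancel, Real.rpow_zero, mul_one]
  congr 1
  ring

/-- The change of variables `y = z - e^{-t} x`. -/
lemma integral_comp_sub_exp_neg_smul {F : Type*} [NormedAddCommGroup F] [NormedSpace ℝ F] (d : ℕ)
    (t : ℝ) (z : EuclideanSpace ℝ (Fin d)) (G : EuclideanSpace ℝ (Fin d) → F) :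
    ∫ x, G (z - exp (-t) • x) = exp (t * d) • ∫ y, G y := by
  rw [Measure.integral_comp_smul volume (fun x => G (z - x)) (exp (-t)),
    integral_sub_left_eq_self G volume z, finrank_euclideanSpace_fin, abs_of_pos (by positivity),
    ← exp_nat_mul, ← exp_neg]
  congr 2
  ring

lemma integrable_comp_sub_exp_neg_smul_iff {F : Type*} [NormedAddCommGroup F] (d : ℕ)
    (t : ℝ) (z : EuclideanSpace ℝ (Fin d)) (G : EuclideanSpace ℝ (Fin d) → F) :
    Integrable (fun x => G (z - exp (-t) • x)) ↔ Integrable G := by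
  rw [integrable_comp_smul_iff volume (fun x => G (z - x)) (exp_pos (-t)).ne']
  exact integrable_comp_sub_left G z

/-- Gaussian expectations of functions weighted by `e^{-U(e^t(z-y))}`. -/
lemma integral_gaussMeas_exp_smul {F : Type*} [NormedAddCommGroup F] [NormedSpace ℝ F] (d : ℕ)
    {s : ℝ} (hs : 0 < s) (t : ℝ) (z : EuclideanSpace ℝ (Fin d)) (U : EuclideanSpace ℝ (Fin d) → ℝ)
    (h : EuclideanSpace ℝ (Fin d) → F) :
    ∫ y, exp (-U (exp t • (z - y))) • h y ∂(gaussMeas d s) =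
      ((2 * π * s) ^ (-(d : ℝ) / 2) * exp (-(t * d))) •
        ∫ x, exp (-U x) • exp (-‖z - exp (-t) • x‖ ^ 2 / (2 * s)) • h (z - exp (-t) • x) := by
  rw [gaussMeas, integral_withDensity_ofReal _ _ (fun y => (gaussDens_pos d hs y).le)
    (continuous_gaussDens d s).measurable]
  have key := integral_comp_sub_exp_neg_smul d t z
    fun y => exp (-U (exp t • (z - y))) • exp (-‖y‖ ^ 2 / (2 * s)) • h y
  simp only [sub_sub_cancel, smul_smul, ← exp_add, add_neg_cancel, exp_zero, one_smul] at key ⊢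
  rw [key, smul_smul, mul_assoc, ← exp_add, neg_add_cancel, exp_zero, mul_one, ← integral_smul]
  refine integral_congr_ae (.of_forall fun y => ?_)
  simp only [gaussDens, smul_smul]
  congr 1
  rw [exp_add]
  ring

lemma integrable_gaussMeas_exp_smul_iff {F : Type*} [NormedAddCommGroup F] [NormedSpace ℝ F]
    (d : ℕ) {s : ℝ} (hs : 0 < s) (t : ℝ) (z : EuclideanSpace ℝ (Fin d))
    (U : EuclideanSpace ℝ (Fin d) → ℝ) (h : EuclideanSpace ℝ (Fin d) → F) :
    Integrable (fun y => exp (-U (exp t • (z - y))) • h y) (gaussMeas d s) ↔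
      Integrable fun x =>
        exp (-U x) • exp (-‖z - exp (-t) • x‖ ^ 2 / (2 * s)) • h (z - exp (-t) • x) := by
  rw [gaussMeas, integrable_withDensity_ofReal _ _ (fun y => (gaussDens_pos d hs y).le)
    (continuous_gaussDens d s).measurable]
  have key := integrable_comp_sub_exp_neg_smul_iff d t z
    fun y => exp (-U (exp t • (z - y))) • exp (-‖y‖ ^ 2 / (2 * s)) • h y
  simp only [sub_sub_cancel, smul_smul, ← exp_add, add_neg_cancel, exp_zero, one_smul] at key ⊢
  have hc : (2 * π * s) ^ (-(d : ℝ) / 2) ≠ 0 := by positivity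
  rw [key, ← integrable_fun_smul_iff hc
    (fun y => exp (-U (exp t • (z - y)) + -‖y‖ ^ 2 / (2 * s)) • h y)]
  refine iff_of_eq (congrArg (fun f => Integrable f volume) (funext fun y => ?_))
  simp only [gaussDens, smul_smul]
  congr 1
  rw [exp_add]
  ring

lemma integrable_smul_comp_sub {E F : Type*} [NormedAddCommGroup E] [NormedSpace ℝ E]
    [FiniteDimensional ℝ E] [MeasurableSpace E] [BorelSpace E] [NormedAddCommGroup F]
    [NormedSpace ℝ F] {μ : Measure E} {v : E → ℝ} (hv : Integrable v μ)
    {k : E → F} (hk : Continuous k) {M : ℝ} (hM : ∀ u, ‖k u‖ ≤ M) (r : ℝ) (w : E) :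
    Integrable (fun x => v x • k (w - r • x)) μ :=
  hv.smul_bdd M (by fun_prop : Continuous fun x => k (w - r • x)).aestronglyMeasurable
    (.of_forall fun _ => hM _)

/-- Differentiation under the integral sign for a weighted average of translates. -/
lemma hasFDerivAt_integral_smul_comp_sub {E F : Type*} [NormedAddCommGroup E] [NormedSpace ℝ E]
    [FiniteDimensional ℝ E] [MeasurableSpace E] [BorelSpace E] [NormedAddCommGroup F]
    [NormedSpace ℝ F] (μ : Measure E) (v : E → ℝ) (hv : Integrable v μ)
    (k : E → F) (k' : E → E →L[ℝ] F) (hk : ∀ u, HasFDerivAt k (k' u) u) (hk' : Continuous k')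
    (M M' : ℝ) (hM : ∀ u, ‖k u‖ ≤ M) (hM' : ∀ u, ‖k' u‖ ≤ M') (r : ℝ) (w : E) :
    HasFDerivAt (fun w => ∫ x, v x • k (w - r • x) ∂μ) (∫ x, v x • k' (w - r • x) ∂μ) w := by
  have hkc : Continuous k := continuous_iff_continuousAt.2 fun u => (hk u).continuousAt
  refine hasFDerivAt_integral_of_dominated_of_fderiv_le (s := Set.univ)
    (F' := fun w x => v x • k' (w - r • x)) (bound := fun x => ‖v x‖ * M') Filter.univ_mem
    (.of_forall fun w => ?_) ?_ ?_ ?_ ?_ ?_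
  · exact hv.1.smul (by fun_prop : Continuous fun x => k (w - r • x)).aestronglyMeasurable
  · exact integrable_smul_comp_sub hv hkc hM r w
  · exact hv.1.smul (by fun_prop : Continuous fun x => k' (w - r • x)).aestronglyMeasurable
  · refine .of_forall fun x w _ => ?_
    rw [norm_smul]
    gcongr
    exact hM' _
  · exact hv.norm.mul_const _
  · refine .of_forall fun x w _ => ?_
    exact ((hk (w - r • x)).comp w ((hasFDerivAt_id w).sub_const (r • x))).const_smul (v x)

section GaussianKernel

variable {d : ℕ} {s : ℝ}

lemma hasFDerivAt_gaussKernel (u : EuclideanSpace ℝ (Fin d)) :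
    HasFDerivAt (fun u : EuclideanSpace ℝ (Fin d) => exp (-‖u‖ ^ 2 / (2 * s)))
      (innerSL ℝ ((exp (-‖u‖ ^ 2 / (2 * s)) * -(1 / s)) • u)) u := by
  have h := (((hasStrictFDerivAt_norm_sq u).hasFDerivAt.neg).mul_const (2 * s)⁻¹).exp
  refine (h.congr_fderiv ?_).congr_of_eventuallyEq (.of_forall fun u => by
    simp [div_eq_mul_inv])
  ext e
  simp [div_eq_mul_inv]
  ring

lemma hasFDerivAt_gaussKernel_smul (u : EuclideanSpace ℝ (Fin d)) :
    HasFDerivAt (fun u : EuclideanSpace ℝ (Fin d) => exp (-‖u‖ ^ 2 / (2 * s)) • u)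
      (exp (-‖u‖ ^ 2 / (2 * s)) • ContinuousLinearMap.id ℝ _ +
        (innerSL ℝ ((exp (-‖u‖ ^ 2 / (2 * s)) * -(1 / s)) • u)).smulRight u) u :=
  (hasFDerivAt_gaussKernel u).smul (hasFDerivAt_id u)

lemma gaussKernel_le_one (hs : 0 < s) (u : EuclideanSpace ℝ (Fin d)) :
    exp (-‖u‖ ^ 2 / (2 * s)) ≤ 1 := by
  rw [exp_le_one_iff, neg_div]
  have : 0 ≤ ‖u‖ ^ 2 / (2 * s) := by positivity
  linarith

lemma gaussKernel_mul_norm_sq_le (hs : 0 < s) (u : EuclideanSpace ℝ (Fin d)) :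
    exp (-‖u‖ ^ 2 / (2 * s)) * ‖u‖ ^ 2 ≤ 2 * s := by
  have h := add_one_le_exp (‖u‖ ^ 2 / (2 * s))
  rw [neg_div, exp_neg, inv_mul_le_iff₀ (exp_pos _)]
  have h2 : ‖u‖ ^ 2 / (2 * s) * (2 * s) = ‖u‖ ^ 2 := by field_simp
  nlinarith

lemma gaussKernel_mul_norm_le (hs : 0 < s) (u : EuclideanSpace ℝ (Fin d)) :
    exp (-‖u‖ ^ 2 / (2 * s)) * ‖u‖ ≤ 1 + 2 * s := by
  have h1 := gaussKernel_mul_norm_sq_le hs u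
  have h2 := gaussKernel_le_one hs u
  have h3 : ‖u‖ ≤ 1 + ‖u‖ ^ 2 := by nlinarith [sq_nonneg (‖u‖ - 1), norm_nonneg u]
  nlinarith [mul_le_mul_of_nonneg_left h3 (exp_pos (-‖u‖ ^ 2 / (2 * s))).le]

/-- The weighted Gaussian average `∫ v(x) e^{-‖w - r x‖²/(2s)} h(w - r x) dx`. -/
noncomputable def gaussAvg {F : Type*} [NormedAddCommGroup F] [NormedSpace ℝ F]
    (v : EuclideanSpace ℝ (Fin d) → ℝ) (s r : ℝ) (h : EuclideanSpace ℝ (Fin d) → F)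
    (w : EuclideanSpace ℝ (Fin d)) : F :=
  ∫ x, v x • exp (-‖w - r • x‖ ^ 2 / (2 * s)) • h (w - r • x)

variable {v : EuclideanSpace ℝ (Fin d) → ℝ} {r : ℝ}

lemma integrable_smul_gaussKernel_one (hs : 0 < s) (hv : Integrable v)
    (w : EuclideanSpace ℝ (Fin d)) :
    Integrable fun x => v x • exp (-‖w - r • x‖ ^ 2 / (2 * s)) • (1 : ℝ) :=
  integrable_smul_comp_sub (k := fun u => exp (-‖u‖ ^ 2 / (2 * s)) • (1 : ℝ)) hv (by fun_prop)
    (M := 1) (fun u => by simpa using gaussKernel_le_one hs u) r w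

lemma integrable_smul_gaussKernel_id (hs : 0 < s) (hv : Integrable v)
    (w : EuclideanSpace ℝ (Fin d)) :
    Integrable fun x => v x • exp (-‖w - r • x‖ ^ 2 / (2 * s)) • (w - r • x) :=
  integrable_smul_comp_sub (k := fun u => exp (-‖u‖ ^ 2 / (2 * s)) • u) hv (by fun_prop)
    (M := 1 + 2 * s)
    (fun u => by
      rw [norm_smul, Real.norm_of_nonneg (exp_pos _).le]
      exact gaussKernel_mul_norm_le hs u) r w

lemma integrable_smul_gaussKernel_norm_sq (hs : 0 < s) (hv : Integrable v)
    (w : EuclideanSpace ℝ (Fin d)) :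
    Integrable fun x => v x • exp (-‖w - r • x‖ ^ 2 / (2 * s)) • ‖w - r • x‖ ^ 2 :=
  integrable_smul_comp_sub (k := fun u => exp (-‖u‖ ^ 2 / (2 * s)) • ‖u‖ ^ 2) hv (by fun_prop)
    (M := 2 * s)
    (fun u => by
      rw [norm_smul, Real.norm_of_nonneg (exp_pos _).le, Real.norm_of_nonneg (sq_nonneg _)]
      exact gaussKernel_mul_norm_sq_le hs u) r w

lemma gaussAvg_one_pos (hs : 0 < s) (hv : Integrable v)
    (hpos : ∀ x, 0 < v x) (w : EuclideanSpace ℝ (Fin d)) :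
    0 < gaussAvg v s r (fun _ => (1 : ℝ)) w := by
  have hp : ∀ x, 0 < v x • exp (-‖w - r • x‖ ^ 2 / (2 * s)) • (1 : ℝ) := fun x => by
    have := hpos x
    simp only [smul_eq_mul]
    positivity
  rw [gaussAvg, integral_pos_iff_support_of_nonneg (fun x => (hp x).le)
    (integrable_smul_gaussKernel_one hs hv w)]
  have : Function.support (fun x => v x • exp (-‖w - r • x‖ ^ 2 / (2 * s)) • (1 : ℝ)) =
      Set.univ := Function.support_eq_univ fun x => (hp x).ne'
  rw [this]
  exact isOpen_univ.measure_pos _ Set.univ_nonempty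

lemma norm_innerSL_gaussKernel_smul_le (hs : 0 < s) (u : EuclideanSpace ℝ (Fin d)) :
    ‖innerSL ℝ ((exp (-‖u‖ ^ 2 / (2 * s)) * -(1 / s)) • u)‖ ≤ (1 + 2 * s) * (1 / s) := by
  rw [innerSL_apply_norm, norm_smul, norm_mul, Real.norm_of_nonneg (exp_pos _).le, norm_neg,
    Real.norm_of_nonneg (by positivity), mul_right_comm]
  gcongr
  exact gaussKernel_mul_norm_le hs u

/-- The derivative of the Gaussian average of `1`. -/
lemma hasFDerivAt_gaussAvg_one (hs : 0 < s) (hv : Integrable v) (w : EuclideanSpace ℝ (Fin d)) :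
    HasFDerivAt (gaussAvg v s r fun _ => (1 : ℝ))
      (innerSL ℝ ((-(1 / s)) • gaussAvg v s r (fun u => u) w)) w := by
  have h := hasFDerivAt_integral_smul_comp_sub volume v hv _ _
    (fun u => hasFDerivAt_gaussKernel (s := s) u) (by fun_prop) 1 ((1 + 2 * s) * (1 / s))
    (fun u => by
      rw [Real.norm_of_nonneg (exp_pos _).le]
      exact gaussKernel_le_one hs u)
    (norm_innerSL_gaussKernel_smul_le hs) r w
  have hf : gaussAvg v s r (fun _ => (1 : ℝ)) =
      fun w => ∫ x, v x • exp (-‖w - r • x‖ ^ 2 / (2 * s)) := by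
    ext w
    simp [gaussAvg]
  rw [hf]
  refine h.congr_fderiv ?_
  ext e
  have hi := integrable_smul_gaussKernel_id (r := r) hs hv w
  have hi2 := integrable_smul_comp_sub hv
    (k := fun u => innerSL ℝ ((exp (-‖u‖ ^ 2 / (2 * s)) * -(1 / s)) • u)) (by fun_prop)
    (norm_innerSL_gaussKernel_smul_le hs) r w
  rw [ContinuousLinearMap.integral_apply hi2, innerSL_apply_apply, real_inner_smul_left,
    real_inner_comm, gaussAvg, ← integral_inner hi, ← integral_const_mul]
  refine integral_congr_ae (.of_forall fun x => ?_)
  simp only [smul_apply, innerSL_apply_apply,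
    real_inner_smul_right, smul_eq_mul, real_inner_comm]
  ring

/-- The derivative of the Gaussian average of the identity. -/
lemma exists_hasFDerivAt_gaussAvg_id (hs : 0 < s) (hv : Integrable v)
    (w : EuclideanSpace ℝ (Fin d)) :
    ∃ H : EuclideanSpace ℝ (Fin d) →L[ℝ] EuclideanSpace ℝ (Fin d),
      HasFDerivAt (gaussAvg v s r fun u => u) H w ∧
        ∑ i, ⟪H (EuclideanSpace.single i 1), EuclideanSpace.single i 1⟫ =
          d * gaussAvg v s r (fun _ => (1 : ℝ)) w -
            1 / s * gaussAvg v s r (fun u => ‖u‖ ^ 2) w := by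
  have hb : ∀ u : EuclideanSpace ℝ (Fin d), ‖exp (-‖u‖ ^ 2 / (2 * s)) • ContinuousLinearMap.id ℝ
      (EuclideanSpace ℝ (Fin d)) +
      (innerSL ℝ ((exp (-‖u‖ ^ 2 / (2 * s)) * -(1 / s)) • u)).smulRight u‖ ≤ 1 + 2 := fun u => by
    refine (norm_add_le _ _).trans (add_le_add ?_ ?_)
    · rw [norm_smul, Real.norm_of_nonneg (exp_pos _).le]
      exact mul_le_one₀ (gaussKernel_le_one hs u) (norm_nonneg _) ContinuousLinearMap.norm_id_le
    · rw [ContinuousLinearMap.norm_smulRight_apply, innerSL_apply_norm, norm_smul, norm_mul,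
        Real.norm_of_nonneg (exp_pos _).le, norm_neg, Real.norm_of_nonneg (by positivity)]
      have h1 := gaussKernel_mul_norm_sq_le hs u
      have h2 : exp (-‖u‖ ^ 2 / (2 * s)) * (1 / s) * ‖u‖ * ‖u‖ =
          exp (-‖u‖ ^ 2 / (2 * s)) * ‖u‖ ^ 2 / s := by ring
      rw [h2, div_le_iff₀ hs]
      exact h1
  have hc : Continuous fun u : EuclideanSpace ℝ (Fin d) =>
      exp (-‖u‖ ^ 2 / (2 * s)) • ContinuousLinearMap.id ℝ (EuclideanSpace ℝ (Fin d)) +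
      (innerSL ℝ ((exp (-‖u‖ ^ 2 / (2 * s)) * -(1 / s)) • u)).smulRight u := by
    refine Continuous.add (by fun_prop) ?_
    exact (ContinuousLinearMap.smulRightL ℝ _ _).continuous₂.comp
      (f := fun u : EuclideanSpace ℝ (Fin d) =>
        (innerSL ℝ ((exp (-‖u‖ ^ 2 / (2 * s)) * -(1 / s)) • u), u)) (by fun_prop)
  refine ⟨_, hasFDerivAt_integral_smul_comp_sub volume v hv _ _
    (fun u => hasFDerivAt_gaussKernel_smul (s := s) u) hc (1 + 2 * s) (1 + 2)
    (fun u => by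
      rw [norm_smul, Real.norm_of_nonneg (exp_pos _).le]
      exact gaussKernel_mul_norm_le hs u) hb r w, ?_⟩
  have hi := integrable_smul_comp_sub hv hc hb r w
  have hi2 := fun e => hi.apply_continuousLinearMap e
  simp only [ContinuousLinearMap.integral_apply hi, real_inner_comm]
  simp only [← integral_inner (hi2 _)]
  rw [← integral_finsetSum _ fun i _ => (hi2 _).const_inner _, gaussAvg, gaussAvg,
    ← integral_const_mul, ← integral_const_mul,
    ← integral_sub ((integrable_smul_gaussKernel_one hs hv w).const_mul _)
      ((integrable_smul_gaussKernel_norm_sq hs hv w).const_mul _)]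
  refine integral_congr_ae (.of_forall fun x => ?_)
  have hterm : ∀ i : Fin d, ⟪EuclideanSpace.single i (1 : ℝ),
      (v x • (exp (-‖w - r • x‖ ^ 2 / (2 * s)) •
          ContinuousLinearMap.id ℝ (EuclideanSpace ℝ (Fin d)) +
        (innerSL ℝ ((exp (-‖w - r • x‖ ^ 2 / (2 * s)) * -(1 / s)) • (w - r • x))).smulRight
          (w - r • x))) (EuclideanSpace.single i (1 : ℝ))⟫ =
      v x * exp (-‖w - r • x‖ ^ 2 / (2 * s)) * (1 - 1 / s * (w - r • x) i ^ 2) := fun i => by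
    generalize w - r • x = u
    simp only [smul_apply, add_apply, ContinuousLinearMap.smulRight_apply,
      ContinuousLinearMap.id_apply, innerSL_apply_apply, EuclideanSpace.inner_single_left,
      EuclideanSpace.inner_single_right]
    simp
    ring
  simp only [hterm]
  rw [← Finset.mul_sum, Finset.sum_sub_distrib, ← Finset.mul_sum, EuclideanSpace.norm_sq_eq]
  simp
  ring

end GaussianKernel

section Score

variable {d : ℕ} {s r κ : ℝ} {v : EuclideanSpace ℝ (Fin d) → ℝ}

lemma hasFDerivAt_log_gaussAvg (hs : 0 < s) (hκ : 0 < κ) (hv : Integrable v)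
    (hpos : ∀ x, 0 < v x) (w : EuclideanSpace ℝ (Fin d)) :
    HasFDerivAt (fun w => Real.log (κ * gaussAvg v s r (fun _ => (1 : ℝ)) w))
      (innerSL ℝ ((gaussAvg v s r (fun _ => (1 : ℝ)) w)⁻¹ •
        (-(1 / s)) • gaussAvg v s r (fun u => u) w)) w := by
  have hP := gaussAvg_one_pos (r := r) hs hv hpos w
  refine (((hasFDerivAt_gaussAvg_one hs hv w).const_mul κ).log (by positivity)).congr_fderiv ?_
  ext e
  simp only [smul_apply, innerSL_apply_apply, real_inner_smul_left, smul_eq_mul]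
  field_simp

lemma gradient_log_gaussAvg (hs : 0 < s) (hκ : 0 < κ) (hv : Integrable v)
    (hpos : ∀ x, 0 < v x) (w : EuclideanSpace ℝ (Fin d)) :
    gradient (fun w => Real.log (κ * gaussAvg v s r (fun _ => (1 : ℝ)) w)) w =
      (gaussAvg v s r (fun _ => (1 : ℝ)) w)⁻¹ • (-(1 / s)) • gaussAvg v s r (fun u => u) w := by
  refine HasGradientAt.gradient ?_
  exact hasFDerivAt_log_gaussAvg hs hκ hv hpos w

lemma laplacian_log_gaussAvg (hs : 0 < s) (hκ : 0 < κ) (hv : Integrable v)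
    (hpos : ∀ x, 0 < v x) (z : EuclideanSpace ℝ (Fin d)) :
    ∑ i : Fin d, iteratedFDeriv ℝ 2
        (fun w => Real.log (κ * gaussAvg v s r (fun _ => (1 : ℝ)) w)) z
        ![EuclideanSpace.single i 1, EuclideanSpace.single i 1] =
      -(d / s) + (gaussAvg v s r (fun u => ‖u‖ ^ 2) z / gaussAvg v s r (fun _ => (1 : ℝ)) z) /
        s ^ 2 -
        ‖gradient (fun w => Real.log (κ * gaussAvg v s r (fun _ => (1 : ℝ)) w)) z‖ ^ 2 := by
  have hP := gaussAvg_one_pos (r := r) hs hv hpos z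
  obtain ⟨H, hH, hHtr⟩ := exists_hasFDerivAt_gaussAvg_id (r := r) hs hv z
  have hfd : fderiv ℝ (fun w => Real.log (κ * gaussAvg v s r (fun _ => (1 : ℝ)) w)) =
      fun w => innerSL ℝ ((gaussAvg v s r (fun _ => (1 : ℝ)) w)⁻¹ •
        (-(1 / s)) • gaussAvg v s r (fun u => u) w) :=
    funext fun w => (hasFDerivAt_log_gaussAvg hs hκ hv hpos w).fderiv
  have hP1 := (hasDerivAt_inv hP.ne').comp_hasFDerivAt z (hasFDerivAt_gaussAvg_one (r := r) hs hv z)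
  have hG := hP1.smul (hH.const_smul (-(1 / s)))
  have hJ := ((innerSL ℝ : EuclideanSpace ℝ (Fin d) →L[ℝ] _).hasFDerivAt).comp z hG
  have hfd2 : ∀ e : EuclideanSpace ℝ (Fin d), iteratedFDeriv ℝ 2
      (fun w => Real.log (κ * gaussAvg v s r (fun _ => (1 : ℝ)) w)) z ![e, e] =
      (gaussAvg v s r (fun _ => (1 : ℝ)) z)⁻¹ * (-(1 / s)) * ⟪H e, e⟫ -
      (⟪gradient (fun w => Real.log (κ * gaussAvg v s r (fun _ => (1 : ℝ)) w)) z, e⟫) ^ 2 := by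
    intro e
    rw [iteratedFDeriv_two_apply, hfd]
    have hJ' := hJ.fderiv
    change fderiv ℝ (fun w => innerSL ℝ ((gaussAvg v s r (fun _ => (1 : ℝ)) w)⁻¹ •
      (-(1 / s)) • gaussAvg v s r (fun u => u) w)) z = _ at hJ'
    rw [hJ', gradient_log_gaussAvg hs hκ hv hpos]
    have hin : ∀ a b : EuclideanSpace ℝ (Fin d), ((innerSL ℝ :
        EuclideanSpace ℝ (Fin d) →L[ℝ] EuclideanSpace ℝ (Fin d) →L[ℝ] ℝ) a) b = ⟪a, b⟫ :=
      fun _ _ => rfl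
    simp [real_inner_smul_left, hin]
    ring
  simp only [hfd2]
  rw [Finset.sum_sub_distrib, ← Finset.mul_sum, hHtr]
  simp only [EuclideanSpace.inner_single_right]
  rw [EuclideanSpace.norm_sq_eq]
  simp
  field_simp
  ring

end Score

lemma ouDensity_eq (d : ℕ) (W : EuclideanSpace ℝ (Fin d) → ℝ) (t : ℝ)
    (w : EuclideanSpace ℝ (Fin d)) :
    ouDensity d W t w = (2 * π * (1 - exp (-2 * t))) ^ (-(d : ℝ) / 2) / (∫ y, exp (-W y)) *
      gaussAvg (fun x => exp (-W x)) (1 - exp (-2 * t)) (exp (-t)) (fun _ => (1 : ℝ)) w := by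
  rw [ouDensity, gaussAvg, div_mul_eq_mul_div, mul_div_assoc, ← integral_div]
  congr 1
  refine integral_congr_ae (.of_forall fun x => ?_)
  simp only [smul_eq_mul]
  ring

/-- The estimate comparing the error of the weighted average with the target bound. -/
lemma error_bound_le {n L s R Q M : ℝ} (hn : 0 < n) (hL : 1 ≤ L) (hs : 0 < s) (hs1 : s ≤ 1)
    (hR : 0 ≤ R) (hQ : 0 ≤ Q) (hM : 0 ≤ M) :
    (1 / s) ^ 2 * (8 / n * (Q * R + (2 * M + 8 * s * L) * R + s)) ≤
      32 * exp 2 * L / (n * s) * (1 + ((Q + M) / s ^ 2 + 1) * R) := by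
  have he : 2 ≤ exp 2 := by linarith [add_one_le_exp (2 : ℝ)]
  have h1 : (1 / s) ^ 2 * (8 / n * (Q * R + (2 * M + 8 * s * L) * R + s)) =
      1 / (n * s) * (8 * (Q * R / s) + 16 * (M * R / s) + 64 * (L * R) + 8) := by
    field_simp
    ring
  have h2 : 32 * exp 2 * L / (n * s) * (1 + ((Q + M) / s ^ 2 + 1) * R) =
      1 / (n * s) * (32 * exp 2 * L * (1 + (Q * R / s + M * R / s) / s + R)) := by
    field_simp
    ring
  rw [h1, h2]
  refine mul_le_mul_of_nonneg_left ?_ (by positivity)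
  set a := Q * R / s with ha
  set b := M * R / s with hb
  have ha0 : 0 ≤ a := by positivity
  have hb0 : 0 ≤ b := by positivity
  have hab : a + b ≤ (a + b) / s := le_div_self (by positivity) hs hs1
  calc 8 * a + 16 * b + 64 * (L * R) + 8 ≤ 32 * 2 * L * (1 + (a + b) + R) := by
        nlinarith [mul_nonneg (sub_nonneg.2 hL) ha0, mul_nonneg (sub_nonneg.2 hL) hb0]
    _ ≤ _ := by gcongr

/-- non-asymptotic quadratic error of the self-normalized estimator. With
`y₁, …, yₙ` i.i.d. `N(0, (1-e^{-2t}) I_d)` (expectation written against the product Gaussian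
density), `E[‖ŝ_{t,n}(z) - ∇ log p_t^V(z)‖²] ≤ (32 e² (d + log n)/(n(1-e^{-2t})))
  (1 + θ_t(z) p_t^{2V}(z) Z_{2V} e^{td} / (p_t^V(z) Z_V)²)` where
`θ_t(z) = Δ log p_t^{2V}(z) + d/(1-e^{-2t}) + ‖∇ log p_t^V(z)‖² + ‖∇ log p_t^{2V}(z)‖² + 1`. -/
theorem self_normalized_estimator_error
    (d : ℕ) (hd : 1 ≤ d) (V : EuclideanSpace ℝ (Fin d) → ℝ)
    (hV : Continuous V)
    (hint : Integrable fun x : EuclideanSpace ℝ (Fin d) => exp (-V x))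
    (hint2 : Integrable fun x : EuclideanSpace ℝ (Fin d) => exp (-(2 * V x)))
    (t : ℝ) (ht : 0 < t) (n : ℕ) (hn : 1 ≤ n) (z : EuclideanSpace ℝ (Fin d)) :
    ∫⁻ y : Fin n → EuclideanSpace ℝ (Fin d),
        ENNReal.ofReal ((∏ i, gaussDens d (1 - exp (-2 * t)) (y i)) *
          ‖selfNormEst d n V t z y -
            gradient (fun w => Real.log (ouDensity d V t w)) z‖ ^ 2) ≤
      ENNReal.ofReal
        (32 * exp 2 * (d + Real.log n) / (n * (1 - exp (-2 * t))) *
          (1 +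
            ((∑ i : Fin d,
                iteratedFDeriv ℝ 2
                  (fun w => Real.log (ouDensity d (fun x => 2 * V x) t w)) z
                  ![EuclideanSpace.single i 1, EuclideanSpace.single i 1]) +
              d / (1 - exp (-2 * t)) +
              ‖gradient (fun w => Real.log (ouDensity d V t w)) z‖ ^ 2 +
              ‖gradient (fun w => Real.log (ouDensity d (fun x => 2 * V x) t w)) z‖ ^ 2 +
              1) *
            (ouDensity d (fun x => 2 * V x) t z *
              (∫ x : EuclideanSpace ℝ (Fin d), exp (-(2 * V x))) * exp (t * d)) /
            (ouDensity d V t z * ∫ x : EuclideanSpace ℝ (Fin d), exp (-V x)) ^ 2)) := by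
  set s := 1 - exp (-2 * t) with hs_def
  have hs : 0 < s := by
    have : exp (-2 * t) < 1 := exp_lt_one_iff.2 (by linarith)
    linarith
  have hs1 : s ≤ 1 := by linarith [exp_pos (-2 * t)]
  have hn0 : (0 : ℝ) < n := by exact_mod_cast hn
  have hL : 1 ≤ d + Real.log n := by
    have h1 : 0 ≤ Real.log n := Real.log_nonneg (by exact_mod_cast hn)
    have h2 : (1 : ℝ) ≤ d := by exact_mod_cast hd
    linarith
  have hZ1 : 0 < ∫ x : EuclideanSpace ℝ (Fin d), exp (-V x) := integral_exp_pos hint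
  have hZ2 : 0 < ∫ x : EuclideanSpace ℝ (Fin d), exp (-(2 * V x)) := integral_exp_pos hint2
  set Z1 := ∫ x : EuclideanSpace ℝ (Fin d), exp (-V x) with hZ1_def
  set Z2 := ∫ x : EuclideanSpace ℝ (Fin d), exp (-(2 * V x)) with hZ2_def
  set c := (2 * π * s) ^ (-(d : ℝ) / 2) with hc_def
  have hc : 0 < c := by positivity
  set P1 := gaussAvg (fun x => exp (-V x)) s (exp (-t)) (fun _ => (1 : ℝ)) z with hP1_def
  set P2 := gaussAvg (fun x => exp (-(2 * V x))) s (exp (-t)) (fun _ => (1 : ℝ)) z with hP2_def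
  set Q1 := gaussAvg (fun x => exp (-V x)) s (exp (-t)) (fun u => u) z with hQ1_def
  set T2 := gaussAvg (fun x => exp (-(2 * V x))) s (exp (-t)) (fun u => ‖u‖ ^ 2) z with hT2_def
  have hP1 : 0 < P1 := gaussAvg_one_pos hs hint (fun x => exp_pos _) z
  have hP2 : 0 < P2 := gaussAvg_one_pos hs hint2 (fun x => exp_pos _) z
  have hT2 : 0 ≤ T2 := integral_nonneg fun x => by
    simp only [smul_eq_mul, Pi.zero_apply]
    positivity
  have hou1 : (ouDensity d V t) = fun w => c / Z1 *
      gaussAvg (fun x => exp (-V x)) s (exp (-t)) (fun _ => (1 : ℝ)) w :=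
    funext fun w => ouDensity_eq d V t w
  have hou2 : (ouDensity d (fun x => 2 * V x) t) = fun w => c / Z2 *
      gaussAvg (fun x => exp (-(2 * V x))) s (exp (-t)) (fun _ => (1 : ℝ)) w :=
    funext fun w => ouDensity_eq d (fun x => 2 * V x) t w
  rw [hou1, hou2, laplacian_log_gaussAvg hs (div_pos hc hZ2) hint2 (fun x => exp_pos _) z]
  set G2 := gradient (fun w => Real.log (c / Z2 *
    gaussAvg (fun x => exp (-(2 * V x))) s (exp (-t)) (fun _ => (1 : ℝ)) w)) z
  rw [gradient_log_gaussAvg hs (div_pos hc hZ1) hint (fun x => exp_pos _) z]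
  simp only [← hP1_def, ← hP2_def, ← hQ1_def, ← hT2_def]
  set m := P1⁻¹ • Q1 with hm_def
  have hgrad : P1⁻¹ • (-(1 / s)) • Q1 = (-(1 / s)) • m := by
    rw [hm_def, smul_comm]
  rw [hgrad]
  set w : EuclideanSpace ℝ (Fin d) → ℝ := fun y => exp (-V (exp t • (z - y))) with hw_def
  have hwc : Continuous w := by fun_prop
  have hw_sq : ∀ y, w y ^ 2 = exp (-(2 * V (exp t • (z - y)))) := fun y => by
    rw [hw_def, ← exp_nat_mul]
    congr 1
    push_cast
    ring
  set ρ := c * exp (-(t * d)) with hρ_def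
  have hρ : 0 < ρ := by positivity
  have hprob := isProbabilityMeasure_gaussMeas d hs
  have hA : ∫ y, w y ∂(gaussMeas d s) = ρ * P1 := by
    have h := integral_gaussMeas_exp_smul d hs t z V fun _ => (1 : ℝ)
    simpa only [smul_eq_mul, mul_one, hP1_def, gaussAvg] using h
  have hB : ∫ y, w y ^ 2 ∂(gaussMeas d s) = ρ * P2 := by
    have h := integral_gaussMeas_exp_smul d hs t z (fun x => 2 * V x) fun _ => (1 : ℝ)
    simpa only [smul_eq_mul, mul_one, hP2_def, gaussAvg, hw_sq] using h
  have hC : ∫ y, w y ^ 2 * ‖y‖ ^ 2 ∂(gaussMeas d s) = ρ * T2 := by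
    have h := integral_gaussMeas_exp_smul d hs t z (fun x => 2 * V x) fun y => ‖y‖ ^ 2
    simpa only [smul_eq_mul, hT2_def, gaussAvg, hw_sq] using h
  have hM : ∫ y, w y • y ∂(gaussMeas d s) = (ρ * P1) • m := by
    have h := integral_gaussMeas_exp_smul d hs t z V fun y => y
    rw [hm_def, smul_smul, mul_assoc, mul_inv_cancel₀ hP1.ne', mul_one]
    exact h
  have hiB : Integrable (fun y => w y ^ 2) (gaussMeas d s) := by
    have h := (integrable_gaussMeas_exp_smul_iff d hs t z (fun x => 2 * V x)
      fun _ => (1 : ℝ)).2 (integrable_smul_gaussKernel_one hs hint2 z)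
    simpa only [smul_eq_mul, mul_one, hw_sq] using h
  have hiC : Integrable (fun y => w y ^ 2 * ‖y‖ ^ 2) (gaussMeas d s) := by
    have h := (integrable_gaussMeas_exp_smul_iff d hs t z (fun x => 2 * V x)
      fun y => ‖y‖ ^ 2).2 (integrable_smul_gaussKernel_norm_sq hs hint2 z)
    simpa only [smul_eq_mul, hw_sq] using h
  have hmain := lintegral_norm_weighted_average_sub_sq_le hn (gaussMeas d s) w hwc
    (fun y => exp_pos _) hiB hiC hs (integrable_exp_norm_sq_gaussMeas d hs)
    (integral_exp_norm_sq_gaussMeas d hs).le hA (by positivity) hM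
  rw [hB, hC] at hmain
  have hLHS : ∫⁻ y : Fin n → EuclideanSpace ℝ (Fin d),
      ENNReal.ofReal ((∏ i, gaussDens d s (y i)) *
        ‖selfNormEst d n V t z y - (-(1 / s)) • m‖ ^ 2) =
      ENNReal.ofReal ((1 / s) ^ 2) * ∫⁻ y : Fin n → EuclideanSpace ℝ (Fin d),
        ENNReal.ofReal (‖(∑ i, w (y i))⁻¹ • ∑ i, w (y i) • y i - m‖ ^ 2)
          ∂(Measure.pi fun _ => gaussMeas d s) := by
    have hmeas : Measurable fun y : Fin n → EuclideanSpace ℝ (Fin d) =>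
        ENNReal.ofReal (∏ i, gaussDens d s (y i)) := by
      have := continuous_gaussDens d s
      fun_prop
    have hmeas2 : Measurable fun y : Fin n → EuclideanSpace ℝ (Fin d) =>
        ENNReal.ofReal (‖(∑ i, w (y i))⁻¹ • ∑ i, w (y i) • y i - m‖ ^ 2) := by
      have := hwc.measurable
      fun_prop
    simp only [gaussMeas]
    rw [pi_withDensity_ofReal volume n (gaussDens d s) (fun y => (gaussDens_pos d hs y).le)
      (integrable_gaussDens d hs), lintegral_withDensity_eq_lintegral_mul _ hmeas hmeas2,
      ← lintegral_const_mul _ (hmeas.mul hmeas2), volume_pi]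
    refine lintegral_congr fun y => ?_
    have hprod : 0 ≤ ∏ i, gaussDens d s (y i) :=
      Finset.prod_nonneg fun i _ => (gaussDens_pos d hs _).le
    have hnorm : ‖selfNormEst d n V t z y - (-(1 / s)) • m‖ ^ 2 =
        (1 / s) ^ 2 * ‖(∑ i, w (y i))⁻¹ • ∑ i, w (y i) • y i - m‖ ^ 2 := by
      rw [selfNormEst, ← hs_def, ← smul_sub, norm_smul, mul_pow, norm_neg, Real.norm_eq_abs,
        sq_abs]
    rw [hnorm, Pi.mul_apply, ← ENNReal.ofReal_mul hprod, ← ENNReal.ofReal_mul (by positivity)]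
    congr 1
    ring
  rw [hLHS]
  refine (mul_le_mul_right hmain _).trans ?_
  rw [← ENNReal.ofReal_mul (by positivity)]
  refine ENNReal.ofReal_le_ofReal ?_
  have hfin := error_bound_le (R := P2 / (ρ * P1 ^ 2)) (Q := T2 / P2) (M := ‖m‖ ^ 2) hn0 hL hs hs1
    (by positivity) (by positivity) (by positivity)
  have eR : c / Z2 * P2 * Z2 * exp (t * d) / (c / Z1 * P1 * Z1) ^ 2 = P2 / (ρ * P1 ^ 2) := by
    rw [hρ_def, exp_neg]
    field_simp
  have eC : ρ * T2 / (ρ * P1) ^ 2 = T2 / P2 * (P2 / (ρ * P1 ^ 2)) := by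
    field_simp
  have eB : ρ * P2 / (ρ * P1) ^ 2 = P2 / (ρ * P1 ^ 2) := by
    field_simp
  have eθ : -(d / s) + T2 / P2 / s ^ 2 - ‖G2‖ ^ 2 + d / s + ‖(-(1 / s)) • m‖ ^ 2 + ‖G2‖ ^ 2 + 1 =
      (T2 / P2 + ‖m‖ ^ 2) / s ^ 2 + 1 := by
    rw [norm_smul, mul_pow, norm_neg, Real.norm_eq_abs, sq_abs]
    field_simp
    ring
  rw [eC, eB, eθ, mul_div_assoc ((T2 / P2 + ‖m‖ ^ 2) / s ^ 2 + 1), eR]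
  exact hfin
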